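/- For any ε > 0 there exists a constant C, depending only on ε, h and the graph G (and μ, w), such that for every u ∈ H one has ∫_V h e^u dμ ≤ C · exp(ε ‖∇u‖²_{L²(V)}), where ‖∇u‖²_{L²(V)} = ∫_V |∇u|² dμ. -/

import Mathlib

open Finset

variable {V : Type*}

/-- Integral of `g` over `V` with respect to the measure `μ`. -/
noncomputable def intV [Fintype V] (μ g : V → ℝ) : ℝ := ∑ x, μ x * g x

/-- Volume of `V` with respect to the measure `μ`. -/
noncomputable def volV [Fintype V] (μ : V → ℝ) : ℝ := ∑ x, μ x

/-- The space `H` of functions with zero mean. -/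
def Hsp [Fintype V] (μ : V → ℝ) : Set (V → ℝ) := {u | intV μ u = 0}

/-- `|∇u|²(x)`, the squared length of the gradient of `u` at `x`. -/
noncomputable def gradSq [Fintype V] (G : SimpleGraph V) [DecidableRel G.Adj]
    (w : V → V → ℝ) (μ : V → ℝ) (u : V → ℝ) (x : V) : ℝ :=
  (1 / (2 * μ x)) * ∑ y, if G.Adj x y then w x y * (u y - u x) ^ 2 else 0

/-- The `μ`-Laplacian `Δu(x)`. -/
noncomputable def lapV [Fintype V] (G : SimpleGraph V) [DecidableRel G.Adj]
    (w : V → V → ℝ) (μ : V → ℝ) (u : V → ℝ) (x : V) : ℝ :=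
  (1 / μ x) * ∑ y, if G.Adj x y then w x y * (u y - u x) else 0

/-- The functional `J_β`. -/
noncomputable def Jb [Fintype V] (G : SimpleGraph V) [DecidableRel G.Adj]
    (w : V → V → ℝ) (μ h : V → ℝ) (β : ℝ) (u : V → ℝ) : ℝ :=
  (1 / 2) * intV μ (gradSq G w μ u)
    - β * Real.log (intV μ (fun x => h x * Real.exp (u x)))

/-- The functional `J_{α,β}`. -/
noncomputable def Jab [Fintype V] (G : SimpleGraph V) [DecidableRel G.Adj]
    (w : V → V → ℝ) (μ h : V → ℝ) (α β : ℝ) (u : V → ℝ) : ℝ :=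
  (1 / 2) * intV μ (fun x => gradSq G w μ u x - α * u x ^ 2)
    - β * Real.log (intV μ (fun x => h x * Real.exp (u x)))

/-- The first non-zero eigenvalue `λ₁(V)` of `-Δ`, defined variationally. -/
noncomputable def lam1V [Fintype V] (G : SimpleGraph V) [DecidableRel G.Adj]
    (w : V → V → ℝ) (μ : V → ℝ) : ℝ :=
  sInf ((fun u => intV μ (gradSq G w μ u)) ''
    {u | u ∈ Hsp μ ∧ intV μ (fun x => u x ^ 2) = 1})

/-- The eigenspace of `-Δ` with eigenvalue `c` (inside `H`). -/
def eigSp [Fintype V] (G : SimpleGraph V) [DecidableRel G.Adj]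
    (w : V → V → ℝ) (μ : V → ℝ) (c : ℝ) : Set (V → ℝ) :=
  {v | intV μ v = 0 ∧ ∀ x, -(lapV G w μ v x) = c * v x}

/-- `E_k^⊥`: functions in `H` orthogonal to the eigenspaces of the first `k`
distinct non-zero eigenvalues (`lam` lists the distinct non-zero eigenvalues,
0-indexed, so `lam ⟨s⟩` is `λ_{s+1}(V)`). -/
def EkPerp [Fintype V] (G : SimpleGraph V) [DecidableRel G.Adj]
    (w : V → V → ℝ) (μ : V → ℝ) {m : ℕ} (lam : Fin m → ℝ) (k : ℕ) : Set (V → ℝ) :=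
  {u | u ∈ Hsp μ ∧ ∀ s : Fin m, (s : ℕ) < k → ∀ v ∈ eigSp G w μ (lam s),
    intV μ (fun x => u x * v x) = 0}

theorem intV_gradSq_eq [Fintype V] (G : SimpleGraph V) [DecidableRel G.Adj]
    (w : V → V → ℝ) (μ : V → ℝ) (hμ : ∀ x, 0 < μ x) (u : V → ℝ) :
    intV μ (gradSq G w μ u) =
      ∑ x, ∑ y, (1 / 2) * (if G.Adj x y then w x y * (u y - u x) ^ 2 else 0) := by
  unfold intV gradSq
  refine Finset.sum_congr rfl fun x _ => ?_
  have hx := (hμ x).ne'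
  rw [← Finset.mul_sum]
  field_simp

theorem ite_weight_sq_nonneg (G : SimpleGraph V) [DecidableRel G.Adj]
    (w : V → V → ℝ) (hwp : ∀ x y, G.Adj x y → 0 < w x y) (u : V → ℝ) (x y : V) :
    0 ≤ (1 / 2 : ℝ) * (if G.Adj x y then w x y * (u y - u x) ^ 2 else 0) := by
  split_ifs with hxy
  · have := hwp x y hxy
    positivity
  · simp

theorem intV_gradSq_nonneg [Fintype V] (G : SimpleGraph V) [DecidableRel G.Adj]
    (w : V → V → ℝ) (hwp : ∀ x y, G.Adj x y → 0 < w x y)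
    (μ : V → ℝ) (hμ : ∀ x, 0 < μ x) (u : V → ℝ) :
    0 ≤ intV μ (gradSq G w μ u) := by
  rw [intV_gradSq_eq G w μ hμ]
  exact Finset.sum_nonneg fun x _ => Finset.sum_nonneg fun y _ =>
    ite_weight_sq_nonneg G w hwp u x y

/-- Along an edge, the increment of `u` is controlled by its Dirichlet energy. -/
theorem weight_mul_sq_le_intV_gradSq [Fintype V] (G : SimpleGraph V) [DecidableRel G.Adj]
    (w : V → V → ℝ) (hwp : ∀ x y, G.Adj x y → 0 < w x y)
    (μ : V → ℝ) (hμ : ∀ x, 0 < μ x) (u : V → ℝ) {x y : V} (hxy : G.Adj x y) :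
    (1 / 2) * (w x y * (u y - u x) ^ 2) ≤ intV μ (gradSq G w μ u) := by
  rw [intV_gradSq_eq G w μ hμ]
  have hnonneg := ite_weight_sq_nonneg G w hwp u
  have hy := Finset.single_le_sum (fun z _ => hnonneg x z) (Finset.mem_univ y)
  have hx := Finset.single_le_sum
    (f := fun x => ∑ y, (1 / 2) * (if G.Adj x y then w x y * (u y - u x) ^ 2 else 0))
    (fun z _ => Finset.sum_nonneg fun y _ => hnonneg z y) (Finset.mem_univ x)
  rw [if_pos hxy] at hy
  exact hy.trans hx

/-- The increment of `u` between two vertices joined by a walk is controlled by the square root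
of its Dirichlet energy. -/
theorem exists_sub_le_mul_sqrt_of_walk [Fintype V] (G : SimpleGraph V) [DecidableRel G.Adj]
    (w : V → V → ℝ) (hwp : ∀ x y, G.Adj x y → 0 < w x y)
    (μ : V → ℝ) (hμ : ∀ x, 0 < μ x) {x y : V} (p : G.Walk x y) :
    ∃ K : ℝ, 0 ≤ K ∧ ∀ u : V → ℝ, u y - u x ≤ K * √(intV μ (gradSq G w μ u)) := by
  induction p with
  | nil => exact ⟨0, le_rfl, fun u => by simp⟩
  | @cons a b c hab _ ih =>
    obtain ⟨K, hK, hKu⟩ := ih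
    refine ⟨√(2 / w a b) + K, by positivity, fun u => ?_⟩
    have hw := hwp a b hab
    have hedge : u b - u a ≤ √(2 / w a b) * √(intV μ (gradSq G w μ u)) := by
      rw [← Real.sqrt_mul (by positivity)]
      apply Real.le_sqrt_of_sq_le
      rw [div_mul_eq_mul_div, le_div_iff₀ hw]
      linarith [weight_mul_sq_le_intV_gradSq G w hwp μ hμ u hab]
    linarith [hKu u]

/-- A function of zero mean is bounded above by a multiple of the square root of its
Dirichlet energy. -/
theorem exists_forall_mem_Hsp_le_mul_sqrt [Fintype V] (G : SimpleGraph V) [DecidableRel G.Adj]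
    (hG : G.Connected) (w : V → V → ℝ) (hwp : ∀ x y, G.Adj x y → 0 < w x y)
    (μ : V → ℝ) (hμ : ∀ x, 0 < μ x) :
    ∃ K : ℝ, ∀ u ∈ Hsp μ, ∀ x, u x ≤ K * √(intV μ (gradSq G w μ u)) := by
  have := hG.nonempty
  choose K hK hKu using fun x y =>
    exists_sub_le_mul_sqrt_of_walk G w hwp μ hμ (hG.preconnected x y).some
  refine ⟨∑ x, ∑ y, K x y, fun u hu y => ?_⟩
  obtain ⟨x, hx⟩ : ∃ x, u x ≤ 0 := by
    by_contra! hpos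
    have hsum : 0 < ∑ x, μ x * u x :=
      Finset.sum_pos (fun x _ => mul_pos (hμ x) (hpos x)) Finset.univ_nonempty
    exact hsum.ne' hu
  have hle : K x y ≤ ∑ x, ∑ y, K x y :=
    (Finset.single_le_sum (fun z _ => hK x z) (Finset.mem_univ y)).trans
      (Finset.single_le_sum (f := fun x => ∑ y, K x y)
        (fun z _ => Finset.sum_nonneg fun y _ => hK z y) (Finset.mem_univ x))
  have hmul := mul_le_mul_of_nonneg_right hle (Real.sqrt_nonneg (intV μ (gradSq G w μ u)))
  linarith [hKu x y u]

theorem stmt18 [Fintype V] (G : SimpleGraph V) [DecidableRel G.Adj]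
    (hG : G.Connected) (w : V → V → ℝ) (hws : ∀ x y, w x y = w y x)
    (hwp : ∀ x y, G.Adj x y → 0 < w x y)
    (μ : V → ℝ) (hμ : ∀ x, 0 < μ x) (h : V → ℝ) (hh : ∀ x, 0 < h x) (ε : ℝ) (hε : 0 < ε) :
    ∃ C : ℝ, ∀ u ∈ Hsp μ,
      intV μ (fun x => h x * Real.exp (u x))
        ≤ C * Real.exp (ε * intV μ (gradSq G w μ u)) := by
  obtain ⟨K, hK⟩ := exists_forall_mem_Hsp_le_mul_sqrt G hG w hwp μ hμ
  refine ⟨intV μ h * Real.exp (K ^ 2 / (4 * ε)), fun u hu => ?_⟩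
  have hsq := Real.sq_sqrt (intV_gradSq_nonneg G w hwp μ hμ u)
  have hKu := hK u hu
  set E := intV μ (gradSq G w μ u)
  have hyoung : K * √E ≤ K ^ 2 / (4 * ε) + ε * E := by
    have hdiff : K ^ 2 / (4 * ε) + ε * E - K * √E = (K - 2 * ε * √E) ^ 2 / (4 * ε) := by
      rw [← hsq, Real.sqrt_sq (Real.sqrt_nonneg E)]
      field_simp
      ring
    have : 0 ≤ (K - 2 * ε * √E) ^ 2 / (4 * ε) := by positivity
    linarith
  rw [mul_assoc, ← Real.exp_add]
  unfold intV
  rw [Finset.sum_mul]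
  refine Finset.sum_le_sum fun x _ => ?_
  rw [← mul_assoc]
  exact mul_le_mul_of_nonneg_left (Real.exp_le_exp.2 ((hKu x).trans hyoung))
    (mul_pos (hμ x) (hh x)).le
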